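/- arXiv:2509.24252 — 6 statements merged into one kernel-verified Lean document; each statement's English description precedes it below -/
import Mathlib

section
/- Let A ⊆ {1,…,n} with complement A', and let α, β ∈ ℕ^n. If the subsequence of α indexed by A (in increasing index order) is ≤_des the subsequence of β indexed by A, and the subsequence of α indexed by A' is ≤_des the subsequence of β indexed by A', then α ≤_des β. -/
/-- The weakly decreasing rearrangement of a tuple, as a list. -/
def sortTuple {n : ℕ} (a : Fin n → ℕ) : List ℕ :=
  (List.ofFn a).insertionSort (· ≥ ·)

/-- The strict descent order `<_des` on exponent tuples. -/
def desLT {n : ℕ} (a b : Fin n → ℕ) : Prop :=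
  List.Lex (· < ·) (sortTuple a) (sortTuple b) ∨
    (sortTuple a = sortTuple b ∧ List.Lex (· < ·) (List.ofFn a) (List.ofFn b))

/-- The descent order `≤_des` on exponent tuples. -/
def desLE {n : ℕ} (a b : Fin n → ℕ) : Prop :=
  desLT a b ∨ a = b

/-- The subsequence of `a` indexed by `A`, in increasing index order. -/
def restrictTuple {n : ℕ} (a : Fin n → ℕ) (A : Finset (Fin n)) : Fin A.card → ℕ :=
  fun j => a ((A.orderIsoOfFin rfl j : {x // x ∈ A}) : Fin n)

/-- Weakly decreasing lists compare lexicographically as their multiplicities do at the largest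
value where these differ. -/
theorem exists_count_lt_of_lex {l₁ l₂ : List ℕ} (h : List.Lex (· < ·) l₁ l₂)
    (h₁ : l₁.Pairwise (· ≥ ·)) (h₂ : l₂.Pairwise (· ≥ ·)) :
    ∃ v, (∀ w, v < w → l₁.count w = l₂.count w) ∧ l₁.count v < l₂.count v := by
  induction h with
  | @nil a l =>
    refine ⟨a, fun w hw => ?_, by simp⟩
    rw [List.pairwise_cons] at h₂
    rw [List.count_nil, eq_comm, List.count_eq_zero]
    intro hm
    rcases List.mem_cons.1 hm with rfl | hm
    · exact lt_irrefl _ hw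
    · exact absurd (h₂.1 w hm) (not_le.2 hw)
  | @cons a l₁ l₂ _ ih =>
    obtain ⟨v, hv, hlt⟩ := ih (List.pairwise_cons.1 h₁).2 (List.pairwise_cons.1 h₂).2
    exact ⟨v, fun w hw => by simp [List.count_cons, hv w hw], by simpa [List.count_cons] using hlt⟩
  | @rel a l₁ b l₂ hab =>
    rw [List.pairwise_cons] at h₁ h₂
    have hz : ∀ w, a < w → (a :: l₁).count w = 0 := fun w hw => by
      rw [List.count_eq_zero]
      intro hm
      rcases List.mem_cons.1 hm with rfl | hm
      · exact lt_irrefl _ hw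
      · exact absurd (h₁.1 w hm) (not_le.2 hw)
    refine ⟨b, fun w hw => ?_, by rw [hz b hab]; simp⟩
    rw [hz w (hab.trans hw), eq_comm, List.count_eq_zero]
    intro hm
    rcases List.mem_cons.1 hm with rfl | hm
    · exact lt_irrefl _ hw
    · exact absurd (h₂.1 w hm) (not_le.2 hw)

theorem lex_iff_exists_count_lt {l₁ l₂ : List ℕ}
    (h₁ : l₁.Pairwise (· ≥ ·)) (h₂ : l₂.Pairwise (· ≥ ·)) :
    List.Lex (· < ·) l₁ l₂ ↔
      ∃ v, (∀ w, v < w → l₁.count w = l₂.count w) ∧ l₁.count v < l₂.count v := by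
  refine ⟨fun h => exists_count_lt_of_lex h h₁ h₂, fun ⟨v, hv, hlt⟩ => ?_⟩
  rcases lt_trichotomy l₁ l₂ with h | rfl | h
  · exact h
  · exact absurd hlt (lt_irrefl _)
  · obtain ⟨u, hu, hult⟩ := exists_count_lt_of_lex h h₂ h₁
    rcases lt_trichotomy u v with huv | rfl | huv
    · have := hu v huv
      omega
    · omega
    · have := hv u huv
      omega

theorem lex_ofFn_iff {n : ℕ} (a b : Fin n → ℕ) :
    List.Lex (· < ·) (List.ofFn a) (List.ofFn b) ↔ ∃ i, (∀ j < i, a j = b j) ∧ a i < b i := by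
  induction n with
  | zero => simp
  | succ n ih =>
    rw [List.ofFn_succ, List.ofFn_succ, List.cons_lex_cons_iff, ih, Fin.exists_fin_succ]
    simp [Fin.forall_fin_succ, Fin.succ_lt_succ_iff, and_assoc]

theorem pairwise_sortTuple {n : ℕ} (a : Fin n → ℕ) : (sortTuple a).Pairwise (· ≥ ·) :=
  List.pairwise_insertionSort _ _

theorem count_sortTuple {n : ℕ} (a : Fin n → ℕ) (v : ℕ) :
    (sortTuple a).count v = (Finset.univ.filter fun i => a i = v).card := by
  rw [sortTuple, (List.perm_insertionSort _ _).count_eq, ← Multiset.coe_count,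
    ← Fin.univ_val_map, Multiset.count_map, Finset.card, Finset.filter_val]
  simp only [eq_comm]

theorem count_sortTuple_restrictTuple {n : ℕ} (a : Fin n → ℕ) (A : Finset (Fin n)) (v : ℕ) :
    (sortTuple (restrictTuple a A)).count v = (A.filter fun i => a i = v).card := by
  rw [count_sortTuple]
  refine Finset.card_bij (fun j _ => (A.orderIsoOfFin rfl j : Fin n)) ?_ ?_ ?_
  · intro j hj
    exact Finset.mem_filter.2 ⟨Subtype.property _, (Finset.mem_filter.1 hj).2⟩
  · intro j _ k _ h
    exact (A.orderIsoOfFin rfl).injective (Subtype.ext h)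
  · intro i hi
    rw [Finset.mem_filter] at hi
    refine ⟨(A.orderIsoOfFin rfl).symm ⟨i, hi.1⟩, Finset.mem_filter.2 ⟨Finset.mem_univ _, ?_⟩,
      by simp⟩
    simpa [restrictTuple] using hi.2

theorem count_sortTuple_eq_add {n : ℕ} (a : Fin n → ℕ) (A : Finset (Fin n)) (v : ℕ) :
    (sortTuple a).count v = (sortTuple (restrictTuple a A)).count v +
      (sortTuple (restrictTuple a Aᶜ)).count v := by
  rw [count_sortTuple, count_sortTuple_restrictTuple, count_sortTuple_restrictTuple,
    ← Finset.card_union_of_disjoint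
      (Finset.disjoint_filter_filter disjoint_compl_right), ← Finset.filter_union,
    Finset.union_compl]

theorem sortTuple_eq_of_count_eq {n : ℕ} {a b : Fin n → ℕ}
    (h : ∀ v, (sortTuple a).count v = (sortTuple b).count v) : sortTuple a = sortTuple b :=
  (List.perm_iff_count.2 h).eq_of_pairwise (fun _ _ _ _ h₁ h₂ => le_antisymm h₂ h₁)
    (pairwise_sortTuple a) (pairwise_sortTuple b)

/-- In a tie-broken comparison of subsequences, the first difference goes the right way. -/
theorem le_of_lex_restrictTuple {n : ℕ} {a b : Fin n → ℕ} {A : Finset (Fin n)}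
    (h : List.Lex (· < ·) (List.ofFn (restrictTuple a A)) (List.ofFn (restrictTuple b A)) ∨
      restrictTuple a A = restrictTuple b A)
    {i : Fin n} (hi : i ∈ A) (hlt : ∀ j < i, a j = b j) : a i ≤ b i := by
  set k := (A.orderIsoOfFin rfl).symm ⟨i, hi⟩ with hk
  have hki : ((A.orderIsoOfFin rfl k : {x // x ∈ A}) : Fin n) = i := by simp [hk]
  have hav : ∀ c : Fin n → ℕ, restrictTuple c A k = c i := fun c => by
    rw [restrictTuple, hki]
  rw [← hav a, ← hav b]
  rcases h with h | h
  · obtain ⟨m, hm, hmlt⟩ := (lex_ofFn_iff _ _).1 h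
    rcases lt_trichotomy m k with hmk | rfl | hkm
    · have : ((A.orderIsoOfFin rfl m : {x // x ∈ A}) : Fin n) < i := by
        rw [← hki]
        exact (A.orderIsoOfFin rfl).strictMono hmk
      exact absurd hmlt (not_lt.2 (hlt _ this).ge)
    · exact hmlt.le
    · exact (hm k hkm).le
  · rw [h]

theorem desLE_cases {n : ℕ} {a b : Fin n → ℕ} (h : desLE a b) :
    (∃ v, (∀ w, v < w → (sortTuple a).count w = (sortTuple b).count w) ∧
      (sortTuple a).count v < (sortTuple b).count v) ∨
    (∀ v, (sortTuple a).count v = (sortTuple b).count v) ∧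
      (List.Lex (· < ·) (List.ofFn a) (List.ofFn b) ∨ a = b) := by
  rcases h with (h | ⟨h, hl⟩) | rfl
  · exact .inl ((lex_iff_exists_count_lt (pairwise_sortTuple a) (pairwise_sortTuple b)).1 h)
  · exact .inr ⟨fun v => by rw [h], .inl hl⟩
  · exact .inr ⟨fun _ => rfl, .inr rfl⟩

theorem statement5 (n : ℕ) (A : Finset (Fin n)) (α β : Fin n → ℕ)
    (h1 : desLE (restrictTuple α A) (restrictTuple β A))
    (h2 : desLE (restrictTuple α Aᶜ) (restrictTuple β Aᶜ)) :
    desLE α β := by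
  have of_count : (∃ v, (∀ w, v < w → (sortTuple α).count w = (sortTuple β).count w) ∧
      (sortTuple α).count v < (sortTuple β).count v) → desLE α β := fun h =>
    .inl (.inl ((lex_iff_exists_count_lt (pairwise_sortTuple α) (pairwise_sortTuple β)).2 h))
  simp only [count_sortTuple_eq_add _ A] at of_count
  rcases desLE_cases h1 with ⟨u, hu, hult⟩ | ⟨hc1, hl1⟩ <;>
    rcases desLE_cases h2 with ⟨v, hv, hvlt⟩ | ⟨hc2, hl2⟩
  · refine of_count ⟨max u v, fun w hw => ?_, ?_⟩
    · rw [hu w (by omega), hv w (by omega)]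
    · rcases lt_trichotomy u v with h | rfl | h
      · rw [max_eq_right h.le, hu v h]
        omega
      · rw [max_self]
        omega
      · rw [max_eq_left h.le, hv u h]
        omega
  · exact of_count ⟨u, fun w hw => by rw [hu w hw, hc2], by rw [hc2]; omega⟩
  · exact of_count ⟨v, fun w hw => by rw [hv w hw, hc1], by rw [hc1]; omega⟩
  · by_cases hne : α = β
    · exact .inr hne
    have hs : sortTuple α = sortTuple β := sortTuple_eq_of_count_eq fun v => by
      rw [count_sortTuple_eq_add α A, count_sortTuple_eq_add β A, hc1, hc2]
    obtain ⟨i, hi, hmin⟩ := WellFounded.has_min (wellFounded_lt (α := Fin n))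
      {i | α i ≠ β i} (Function.ne_iff.1 hne)
    have hlt : ∀ j < i, α j = β j := fun j hj => by_contra fun h => hmin j h hj
    refine .inl (.inr ⟨hs, (lex_ofFn_iff _ _).2 ⟨i, hlt, lt_of_le_of_ne ?_ hi⟩⟩)
    by_cases hA : i ∈ A
    · exact le_of_lex_restrictTuple hl1 hA hlt
    · exact le_of_lex_restrictTuple hl2 (Finset.mem_compl.2 hA) hlt
end

section
/- Let z ∈ ℕ^n be a word of nonnegative integers containing at least one 0. Then z = cc(w) for some permutation w ∈ S_n if and only if, for every value c occurring in z, either c is the largest letter occurring in z, or there is an occurrence of c+1 strictly to the left of the rightmost occurrence of c in z. -/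
/-- The cocharge label of the value `v` (`0`-indexed, so `v` represents the letter `v+1`)
in the one-line notation of the permutation `w` (`w j` is the letter at position `j`):
the label of the smallest value is `0`, and the label increases by one exactly at those
steps `i → i+1` where the value `i+1` appears to the left of the value `i`. -/
def ccLabel {n : ℕ} (w : Equiv.Perm (Fin n)) (v : Fin n) : ℕ :=
  (Finset.univ.filter fun i : Fin n =>
    (i : ℕ) + 1 ≤ (v : ℕ) ∧ ∃ h : (i : ℕ) + 1 < n, w.symm ⟨(i : ℕ) + 1, h⟩ < w.symm i).card

/-- The cocharge word of a permutation: `cc w j` is the cocharge label of the letter `w j`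
at position `j`. -/
def cc {n : ℕ} (w : Equiv.Perm (Fin n)) : Fin n → ℕ := fun j => ccLabel w (w j)


theorem ccLabel_zero {n : ℕ} (w : Equiv.Perm (Fin n)) (h : 0 < n) : ccLabel w ⟨0, h⟩ = 0 := by
  simp [ccLabel]

/-- The cocharge label increases by one at a descent of the inverse and is unchanged otherwise. -/
theorem ccLabel_succ {n : ℕ} (w : Equiv.Perm (Fin n)) (i : ℕ) (h : i + 1 < n) :
    ccLabel w ⟨i + 1, h⟩ = ccLabel w ⟨i, by omega⟩ +
      if w.symm ⟨i + 1, h⟩ < w.symm ⟨i, by omega⟩ then 1 else 0 := by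
  unfold ccLabel
  split_ifs with hd
  · rw [← Finset.card_insert_of_notMem (a := (⟨i, by omega⟩ : Fin n)) (by simp)]
    congr 1
    ext ⟨k, hk⟩
    simp only [Finset.mem_filter, Finset.mem_univ, true_and, Finset.mem_insert, Fin.mk.injEq]
    constructor
    · rintro ⟨hki, hdk⟩
      by_cases hk' : k = i
      · exact Or.inl hk'
      · exact Or.inr ⟨by omega, hdk⟩
    · rintro (rfl | ⟨hki, hdk⟩)
      · exact ⟨le_rfl, h, hd⟩
      · exact ⟨by omega, hdk⟩
  · rw [add_zero]
    congr 1
    ext ⟨k, hk⟩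
    simp only [Finset.mem_filter, Finset.mem_univ, true_and]
    constructor
    · rintro ⟨hki, hdk⟩
      refine ⟨?_, hdk⟩
      rcases Nat.lt_or_ge k i with hk' | hk'
      · omega
      · obtain rfl : k = i := by omega
        exact absurd hdk.2 hd
    · rintro ⟨hki, hdk⟩
      exact ⟨by omega, hdk⟩

theorem ccLabel_mono {n : ℕ} (w : Equiv.Perm (Fin n)) : Monotone (ccLabel w) := by
  intro u v huv
  refine Finset.card_le_card fun i hi => ?_
  simp only [Finset.mem_filter, Finset.mem_univ, true_and] at hi ⊢
  exact ⟨hi.1.trans huv, hi.2⟩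

/-- Letters with the same cocharge label appear from left to right in increasing order. -/
theorem symm_le_symm_of_ccLabel_eq {n : ℕ} (w : Equiv.Perm (Fin n)) {u v : Fin n} (huv : u ≤ v)
    (h : ccLabel w u = ccLabel w v) : w.symm u ≤ w.symm v := by
  obtain ⟨v, hv⟩ := v
  induction v with
  | zero => exact le_of_eq (congrArg _ (Fin.ext (Nat.le_zero.mp huv)))
  | succ v ih =>
    rcases huv.eq_or_lt with rfl | hlt
    · exact le_rfl
    · have huv' : u ≤ ⟨v, by omega⟩ := Nat.lt_succ_iff.mp hlt
      have hmono := ccLabel_mono w huv'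
      have hsucc := ccLabel_succ w v hv
      split_ifs at hsucc with hd
      · omega
      · exact (ih (by omega) huv' (by omega)).trans (not_lt.mp hd)

/-- Below a letter of label larger than `c` there is a descent where the label passes from `c`
to `c + 1`. -/
theorem exists_ccLabel_eq_of_lt {n : ℕ} (w : Equiv.Perm (Fin n)) {c : ℕ} {v : Fin n}
    (h : c < ccLabel w v) :
    ∃ u u' : Fin n, ccLabel w u = c ∧ ccLabel w u' = c + 1 ∧ (u' : ℕ) = u + 1 ∧
      w.symm u' < w.symm u := by
  obtain ⟨v, hv⟩ := v
  induction v with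
  | zero => simp [ccLabel_zero] at h
  | succ v ih =>
    by_cases hc : c < ccLabel w ⟨v, by omega⟩
    · exact ih _ hc
    · have hsucc := ccLabel_succ w v hv
      split_ifs at hsucc with hd
      · exact ⟨⟨v, by omega⟩, ⟨v + 1, hv⟩, by omega, by omega, rfl, hd⟩
      · omega

/-- A word is the cocharge word of the inverse of its stable sorting permutation as soon as it
contains a `0` and each non-maximal letter `c` has a `c + 1` to the left of its rightmost
occurrence. -/
theorem ccLabel_symm_sort {n : ℕ} (z : Fin n → ℕ) (h0 : ∃ j, z j = 0)
    (hz : ∀ c : ℕ, (∃ j, z j = c) →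
      ((∀ j, z j ≤ c) ∨
        ∃ j₂ : Fin n, z j₂ = c ∧ (∀ j, z j = c → j ≤ j₂) ∧
          ∃ j₁ : Fin n, j₁ < j₂ ∧ z j₁ = c + 1)) (v : Fin n) :
    ccLabel (Tuple.sort z).symm v = z (Tuple.sort z v) := by
  obtain ⟨hmono, hstable⟩ := Tuple.eq_sort_iff.mp (rfl : Tuple.sort z = Tuple.sort z)
  generalize Tuple.sort z = σ at hmono hstable ⊢
  have hle : ∀ i j, i ≤ j → z (σ i) = z (σ j) → σ i ≤ σ j := fun i j hij hzij =>
    hij.eq_or_lt.elim (fun h => h ▸ le_rfl) fun h => (hstable i j h hzij).le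
  obtain ⟨v, hv⟩ := v
  induction v with
  | zero =>
    obtain ⟨j, hj⟩ := h0
    have h : z (σ ⟨0, hv⟩) ≤ z (σ (σ.symm j)) := hmono (Nat.zero_le _)
    rw [σ.apply_symm_apply] at h
    rw [ccLabel_zero]
    omega
  | succ v ih =>
    have hv' : v < n := by omega
    rw [ccLabel_succ, ih hv', Equiv.symm_symm]
    have hstep : z (σ ⟨v, hv'⟩) ≤ z (σ ⟨v + 1, hv⟩) := hmono (Nat.le_succ v)
    rcases hstep.eq_or_lt with heq | hlt
    · rw [if_neg (hle _ _ (Nat.le_succ v) heq).not_gt, heq, add_zero]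
    · rcases hz _ ⟨_, rfl⟩ with hmax | ⟨j₂, hj₂, -, j₁, hj, hj₁⟩
      · exact absurd (hmax _) hlt.not_ge
      obtain ⟨i₁, rfl⟩ := σ.surjective j₁
      obtain ⟨i₂, rfl⟩ := σ.surjective j₂
      have hi₁ : (⟨v + 1, hv⟩ : Fin n) ≤ i₁ := by
        by_contra! hi
        have : z (σ i₁) ≤ z (σ ⟨v, hv'⟩) := hmono (Nat.lt_succ_iff.mp hi)
        omega
      have hi₂ : i₂ ≤ ⟨v, hv'⟩ := by
        by_contra! hi
        have : z (σ ⟨v + 1, hv⟩) ≤ z (σ i₂) := hmono (Nat.succ_le_of_lt hi)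
        omega
      have hz₁ : z (σ ⟨v + 1, hv⟩) ≤ z (σ i₁) := hmono hi₁
      rw [if_pos (((hle _ _ hi₁ (by omega)).trans_lt hj).trans_le (hle _ _ hi₂ hj₂))]
      omega

theorem statement6 (n : ℕ) (z : Fin n → ℕ) (h0 : ∃ j, z j = 0) :
    (∃ w : Equiv.Perm (Fin n), z = cc w) ↔
      ∀ c : ℕ, (∃ j, z j = c) →
        ((∀ j, z j ≤ c) ∨
          ∃ j₂ : Fin n, z j₂ = c ∧ (∀ j, z j = c → j ≤ j₂) ∧
            ∃ j₁ : Fin n, j₁ < j₂ ∧ z j₁ = c + 1) := by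
  constructor
  · rintro ⟨w, rfl⟩ c -
    by_cases hmax : ∀ j, cc w j ≤ c
    · exact Or.inl hmax
    · push Not at hmax
      obtain ⟨j, hj⟩ := hmax
      obtain ⟨u, u', hu, hu', huu', hlt⟩ := exists_ccLabel_eq_of_lt w hj
      refine Or.inr ⟨w.symm u, by simpa [cc] using hu, fun k hk => ?_, w.symm u', hlt,
        by simpa [cc] using hu'⟩
      have hku : w k ≤ u := by
        by_contra! h
        have hu'k : u' ≤ w k := by rw [Fin.le_def]; omega
        have := ccLabel_mono w hu'k
        simp only [cc] at hk
        omega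
      simpa using symm_le_symm_of_ccLabel_eq w hku (hk.trans hu.symm)
  · intro hz
    refine ⟨(Tuple.sort z).symm, funext fun j => ?_⟩
    simp [cc, ccLabel_symm_sort z h0 hz]
end

section
/- Let n ≥ 2, let w ∈ S_n with z = cc(w), and let m be the position of the rightmost occurrence of the maximal entry of z. Then w_m = n, and the word of length n−1 obtained from z by deleting the entry at position m equals cc(w|_{n−1}), where w|_{n−1} ∈ S_{n−1} is the subword of w consisting of the letters 1,…,n−1. -/
/-- The set of cocharge steps counted by `ccLabel` grows with the value. -/
theorem ccLabel_steps_subset {n : ℕ} (w : Equiv.Perm (Fin n)) {u v : Fin n} (huv : u ≤ v) :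
    (Finset.univ.filter fun i : Fin n =>
      (i : ℕ) + 1 ≤ (u : ℕ) ∧ ∃ h : (i : ℕ) + 1 < n, w.symm ⟨(i : ℕ) + 1, h⟩ < w.symm i) ⊆
    Finset.univ.filter fun i : Fin n =>
      (i : ℕ) + 1 ≤ (v : ℕ) ∧ ∃ h : (i : ℕ) + 1 < n, w.symm ⟨(i : ℕ) + 1, h⟩ < w.symm i :=
  Finset.monotone_filter_right _ fun _ _ hi => ⟨hi.1.trans huv, hi.2⟩

/-- Deleting the largest letter does not change the cocharge labels of the other letters. -/
theorem ccLabel_castSucc {n : ℕ} (w : Equiv.Perm (Fin (n + 1))) (w' : Equiv.Perm (Fin n))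
    (m : Fin (n + 1)) (h : ∀ u, w.symm u.castSucc = m.succAbove (w'.symm u)) (v : Fin n) :
    ccLabel w v.castSucc = ccLabel w' v := by
  unfold ccLabel
  refine (congrArg Finset.card ?_).trans (Finset.card_map Fin.castSuccEmb)
  ext i
  simp only [Finset.mem_filter, Finset.mem_univ, true_and, Finset.mem_map, Fin.val_castSucc,
    Fin.coe_castSuccEmb]
  constructor
  · rintro ⟨hiv, hin, hlt⟩
    have hn : (i : ℕ) + 1 < n := by omega
    refine ⟨⟨i, by omega⟩, ⟨hiv, hn, ?_⟩, rfl⟩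
    rw [← m.succAbove_lt_succAbove_iff, ← h, ← h]
    exact hlt
  · rintro ⟨i, ⟨hiv, hin, hlt⟩, rfl⟩
    refine ⟨hiv, Nat.lt_succ_of_lt hin, ?_⟩
    rw [← m.succAbove_lt_succAbove_iff, ← h, ← h] at hlt
    exact hlt

theorem statement8 (n : ℕ) (hn : 1 ≤ n) (w : Equiv.Perm (Fin (n + 1)))
    (m : Fin (n + 1))
    (hmax : ∀ j, cc w j ≤ cc w m)
    (hright : ∀ j, cc w j = cc w m → j ≤ m) :
    (w m : ℕ) = n ∧
      ∃ w' : Equiv.Perm (Fin n),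
        (∀ j : Fin n, (w' j : ℕ) = (w (m.succAbove j) : ℕ)) ∧
        (fun j : Fin n => cc w (m.succAbove j)) = cc w' := by
  have hlast : w m = Fin.last n := by
    have hlabel : ccLabel w (w m) = ccLabel w (Fin.last n) := by
      refine le_antisymm (ccLabel_mono w (Fin.le_last _)) ?_
      simpa [cc] using hmax (w.symm (Fin.last n))
    have hle := symm_le_symm_of_ccLabel_eq w (Fin.le_last _) hlabel
    have hge := hright (w.symm (Fin.last n)) (by simpa [cc] using hlabel.symm)
    rw [Equiv.symm_apply_apply] at hle
    exact (w.symm_apply_eq.mp (le_antisymm hge hle)).symm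
  refine ⟨by simp [hlast], ?_⟩
  have hne : ∀ j, w (m.succAbove j) ≠ Fin.last n := fun j hj =>
    m.succAbove_ne j (w.injective (hj.trans hlast.symm))
  have hinj : Function.Injective fun j => (w (m.succAbove j)).castPred (hne j) := fun a b hab =>
    Fin.succAbove_right_injective (w.injective (Fin.castPred_inj.mp hab))
  let w' : Equiv.Perm (Fin n) := Equiv.ofBijective _ (Finite.injective_iff_bijective.mp hinj)
  have hw' : ∀ j, (w' j).castSucc = w (m.succAbove j) := fun j => Fin.castSucc_castPred _ (hne j)
  refine ⟨w', fun j => congrArg Fin.val (hw' j), funext fun j => ?_⟩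
  simp only [cc]
  rw [← hw' j]
  refine ccLabel_castSucc w w' m (fun u => ?_) _
  rw [Equiv.symm_apply_eq, ← hw', Equiv.apply_symm_apply]
end

section
/- For every σ ∈ S_n, the descent monomial satisfies g_σ = x^{rev(cc(w))} where w = rev(rev(σ)^{−1}) (here rev(σ) denotes the reversal of the one-line notation of σ, and rev(cc(w)) the reversal of the tuple cc(w)). Consequently, D_n = { rev(cc(w)) : w ∈ S_n }. -/
/-- The exponent vector of the descent monomial `g_σ`: the exponent of `x_p` is the
number of descent positions of `σ` weakly to the right of the position of the letter `p`. -/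
def descentExp {m : ℕ} (σ : Equiv.Perm (Fin m)) : Fin m → ℕ := fun p =>
  (Finset.univ.filter fun i : Fin m =>
    σ.symm p ≤ i ∧ ∃ h : (i : ℕ) + 1 < m, σ ⟨(i : ℕ) + 1, h⟩ < σ i).card

/-- `i ↦ n - 2 - i` matches the descents of `σ` weakly to the right of the letter `p` with the
increments of the cocharge label up to the reversed position of `p`. -/
theorem descentExp_eq_cc {n : ℕ} (σ : Equiv.Perm (Fin n)) (p : Fin n) :
    descentExp σ p = cc ((σ * Fin.revPerm)⁻¹ * Fin.revPerm) p.rev := by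
  have hsymm (i : Fin n) :
      ((σ * Fin.revPerm)⁻¹ * Fin.revPerm).symm i = (σ i.rev).rev := rfl
  have happly : ((σ * Fin.revPerm)⁻¹ * Fin.revPerm) p.rev = (σ.symm p).rev := by
    change (σ.symm p.rev.rev).rev = _
    rw [Fin.rev_rev]
  unfold descentExp cc ccLabel
  simp only [happly, hsymm, Fin.rev_lt_rev]
  refine Finset.card_nbij' (fun i => ⟨n - 2 - i, by omega⟩) (fun i => ⟨n - 2 - i, by omega⟩)
    ?_ ?_ ?_ ?_
  · simp only [Finset.coe_filter, Finset.mem_univ, true_and]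
    rintro i ⟨hp, h, hd⟩
    refine ⟨?_, by dsimp only; omega, ?_⟩
    · rw [Fin.le_def] at hp
      simp only [Fin.val_rev]
      omega
    · convert hd using 2 <;> ext <;> simp only [Fin.val_rev] <;> omega
  · simp only [Finset.coe_filter, Finset.mem_univ, true_and]
    rintro i ⟨hp, h, hd⟩
    refine ⟨?_, by dsimp only; omega, ?_⟩
    · rw [Fin.le_def]
      simp only [Fin.val_rev] at hp ⊢
      omega
    · convert hd using 2 <;> ext <;> simp only [Fin.val_rev] <;> omega
  all_goals
    simp only [Finset.coe_filter, Finset.mem_univ, true_and]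
    rintro i ⟨-, h, -⟩
    ext
    dsimp only
    omega

theorem statement9 (n : ℕ) :
    (∀ σ : Equiv.Perm (Fin n),
        descentExp σ =
          fun p : Fin n => cc ((σ * Fin.revPerm)⁻¹ * Fin.revPerm) p.rev) ∧
    {a : Fin n → ℕ | ∃ σ : Equiv.Perm (Fin n), a = descentExp σ} =
      {a : Fin n → ℕ | ∃ w : Equiv.Perm (Fin n), a = fun p => cc w p.rev} := by
  refine ⟨fun σ => funext (descentExp_eq_cc σ), Set.ext fun a => ⟨?_, ?_⟩⟩
  · rintro ⟨σ, rfl⟩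
    exact ⟨_, funext (descentExp_eq_cc σ)⟩
  · rintro ⟨w, rfl⟩
    refine ⟨(w * Fin.revPerm)⁻¹ * Fin.revPerm, funext fun p => ?_⟩
    rw [descentExp_eq_cc]
    congr 1
    ext i
    simp [Equiv.Perm.inv_def]
end

section
/- Let 0 ≤ k ≤ n, let w ∈ S_n, and let μ = (μ_1 ≥ μ_2 ≥ ⋯ ≥ μ_{n−k} ≥ 0) be a weakly decreasing tuple of nonnegative integers. Then for every 1 ≤ j ≤ n−1, one has cc(w,μ)_j > cc(w,μ)_{j+1} if and only if w_j > w_{j+1}. -/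
/-- The boosted cocharge word `cc(w,μ)`: the cocharge label of the letter `w i` is increased
by `μ_{n - w_i + 1}` whenever the letter `w i` is one of the `n - k` largest letters. -/
def boostedCC {n : ℕ} (k : ℕ) (w : Equiv.Perm (Fin n)) (μ : Fin (n - k) → ℕ) : Fin n → ℕ :=
  fun i =>
    if h : k ≤ (w i : ℕ) then
      cc w i + μ ⟨n - 1 - (w i : ℕ), by have h2 := (w i).isLt; omega⟩
    else cc w i

/-- A permutation that moves a smaller value `a` to the right of a larger value `b` has a
consecutive pair of values between `a` and `b` that appears in inverted order. -/
theorem exists_inverse_descent {n : ℕ} (w : Equiv.Perm (Fin n)) {a b : Fin n} (hab : a ≤ b)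
    (hw : w.symm b < w.symm a) :
    ∃ i : Fin n, a ≤ i ∧ i < b ∧ ∃ h : (i : ℕ) + 1 < n, w.symm ⟨(i : ℕ) + 1, h⟩ < w.symm i := by
  by_contra! hc
  have key : ∀ m : ℕ, (a : ℕ) ≤ m → ∀ hm : m < n, m ≤ (b : ℕ) →
      w.symm a ≤ w.symm ⟨m, hm⟩ := by
    intro m ham
    induction m, ham using Nat.le_induction with
    | base => exact fun _ _ => le_rfl
    | succ m ham ih =>
      intro hm hmb
      have hm' : m < n := by omega
      exact (ih hm' (by omega)).trans
        (hc ⟨m, hm'⟩ (Fin.le_def.2 ham) (Fin.lt_def.2 hmb) hm)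
  exact absurd (key b hab b.isLt le_rfl) (not_le.2 hw)

theorem ccLabel_lt_of_inversion {n : ℕ} (w : Equiv.Perm (Fin n)) {a b : Fin n} (hab : a < b)
    (hw : w.symm b < w.symm a) : ccLabel w a < ccLabel w b := by
  obtain ⟨i, hai, hib, hi⟩ := exists_inverse_descent w hab.le hw
  refine Finset.card_lt_card ((Finset.ssubset_iff_of_subset fun x hx => ?_).2 ⟨i, ?_, ?_⟩)
  · simp only [Finset.mem_filter, Finset.mem_univ, true_and] at hx ⊢
    exact ⟨hx.1.trans hab.le, hx.2⟩
  · simp only [Finset.mem_filter, Finset.mem_univ, true_and]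
    exact ⟨hib, hi⟩
  · simp only [Finset.mem_filter, Finset.mem_univ, true_and]
    exact fun hx => absurd hx.1 (not_le.2 (Nat.lt_succ_of_le hai))

/-- Boosting never shrinks the amount by which the label of a larger letter exceeds the label
of a smaller one. -/
theorem boostedCC_add_cc_le {n k : ℕ} (w : Equiv.Perm (Fin n)) {μ : Fin (n - k) → ℕ}
    (hμ : Antitone μ) {i j : Fin n} (hij : w i ≤ w j) :
    boostedCC k w μ i + cc w j ≤ boostedCC k w μ j + cc w i := by
  have hij' : (w i : ℕ) ≤ w j := hij
  unfold boostedCC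
  split_ifs with hi hj hj
  · have := hμ (show (⟨n - 1 - (w j : ℕ), by omega⟩ : Fin (n - k)) ≤
      ⟨n - 1 - (w i : ℕ), by omega⟩ from Fin.le_def.2 (Nat.sub_le_sub_left hij' _))
    omega
  · omega
  · omega
  · omega

theorem statement11 (n k : ℕ) (hk : k ≤ n) (w : Equiv.Perm (Fin n))
    (μ : Fin (n - k) → ℕ) (hμ : Antitone μ)
    (j : Fin n) (h : (j : ℕ) + 1 < n) :
    boostedCC k w μ ⟨(j : ℕ) + 1, h⟩ < boostedCC k w μ j ↔ w ⟨(j : ℕ) + 1, h⟩ < w j := by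
  have hpos : j < ⟨(j : ℕ) + 1, h⟩ := Fin.lt_def.2 (Nat.lt_succ_self _)
  constructor
  · contrapose!
    intro hle
    have hcc : cc w j ≤ cc w ⟨(j : ℕ) + 1, h⟩ := ccLabel_mono w hle
    have := boostedCC_add_cc_le w hμ hle
    omega
  · intro hlt
    have hcc : cc w ⟨(j : ℕ) + 1, h⟩ < cc w j := ccLabel_lt_of_inversion w hlt (by simpa using hpos)
    have := boostedCC_add_cc_le w hμ hlt.le
    omega
end

section
/- Let λ be a partition of n, let T be a standard Young tableau of shape λ, and let S' be any filling of λ by nonnegative integers. Then ε_T · x_T^{S'} = Σ_{P ∈ snake(T)} (−1)^P x_P^{S'} in ℚ[x_1,…,x_n]. -/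
open MvPolynomial

/-- The cells of a Young diagram, as a type. We use Mathlib's (English) convention,
in which the rows of French notation read from bottom to top correspond to the row
index `c.1` increasing, and `c.2` is the column index. -/
abbrev YDCells (μ : YoungDiagram) : Type := {c : ℕ × ℕ // c ∈ μ.cells}

/-- A bijective filling `T` of `μ` by the values `Fin n` (the value `v : Fin n` stands for
the entry `v+1`) is standard if its entries increase along rows (left to right) and along
columns (from the bottom row of French notation upwards). -/
def IsStandardFilling (μ : YoungDiagram) {n : ℕ} (T : YDCells μ ≃ Fin n) : Prop :=
  (∀ c d : YDCells μ, (c : ℕ × ℕ).1 = (d : ℕ × ℕ).1 → (c : ℕ × ℕ).2 < (d : ℕ × ℕ).2 →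
    T c < T d) ∧
  (∀ c d : YDCells μ, (c : ℕ × ℕ).2 = (d : ℕ × ℕ).2 → (c : ℕ × ℕ).1 < (d : ℕ × ℕ).1 →
    T c < T d)

/-- The row group `R(T)`: permutations of the values preserving each row of `T`. -/
def rowGroup (μ : YoungDiagram) {n : ℕ} (T : YDCells μ ≃ Fin n) :
    Finset (Equiv.Perm (Fin n)) :=
  Finset.univ.filter fun w =>
    ∀ v : Fin n, ((T.symm (w v)) : ℕ × ℕ).1 = ((T.symm v) : ℕ × ℕ).1

/-- The column group `C(T)`: permutations of the values preserving each column of `T`. -/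
def colGroup (μ : YoungDiagram) {n : ℕ} (T : YDCells μ ≃ Fin n) :
    Finset (Equiv.Perm (Fin n)) :=
  Finset.univ.filter fun w =>
    ∀ v : Fin n, ((T.symm (w v)) : ℕ × ℕ).2 = ((T.symm v) : ℕ × ℕ).2

/-- A `T`-snaking: a bijective filling `P` of `μ` such that any two values lying in the
same column of `T` lie in distinct rows of `P`. -/
def IsSnaking (μ : YoungDiagram) {n : ℕ} (T P : YDCells μ ≃ Fin n) : Prop :=
  ∀ v v' : Fin n, v ≠ v' → ((T.symm v) : ℕ × ℕ).2 = ((T.symm v') : ℕ × ℕ).2 →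
    ((P.symm v) : ℕ × ℕ).1 ≠ ((P.symm v') : ℕ × ℕ).1

/-- The total number of inversions of the snaking `P` relative to `T`: the number of pairs
of values in a common column of `T` whose bottom-to-top order in `P` disagrees with their
order in `T`.  The sign `(-1)^P` is `(-1)` to this count. -/
def snakeInv (μ : YoungDiagram) {n : ℕ} (T P : YDCells μ ≃ Fin n) : ℕ :=
  (Finset.univ.filter fun vv : Fin n × Fin n =>
    ((T.symm vv.1) : ℕ × ℕ).2 = ((T.symm vv.2) : ℕ × ℕ).2 ∧ vv.1 < vv.2 ∧
      ((P.symm vv.2) : ℕ × ℕ).1 < ((P.symm vv.1) : ℕ × ℕ).1).card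

/-- The monomial `x_P^{S'} = ∏_{u ∈ μ} x_{P(u)}^{S'(u)}` of a bijective filling `P`
with exponents given by an arbitrary filling `S'`. -/
noncomputable def fillingMonomial (μ : YoungDiagram) {n : ℕ} (P : YDCells μ ≃ Fin n)
    (S' : YDCells μ → ℕ) : MvPolynomial (Fin n) ℚ :=
  ∏ c : YDCells μ, X (P c) ^ S' c

/-- `ε_T · x_T^{S'} = Σ_{τ ∈ C(T), σ ∈ R(T)} sgn(τ) · (τσ) · x_T^{S'}`, where a permutation
`w` acts on polynomials by `(w·f)(x_1,…,x_n) = f(x_{w(1)},…,x_{w(n)})`. -/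
noncomputable def epsilonApplied (μ : YoungDiagram) {n : ℕ} (T : YDCells μ ≃ Fin n)
    (S' : YDCells μ → ℕ) : MvPolynomial (Fin n) ℚ :=
  ∑ τ ∈ colGroup μ T, ∑ σ ∈ rowGroup μ T,
    ((Equiv.Perm.sign τ : ℤ) : ℚ) •
      MvPolynomial.rename (⇑(τ * σ)) (fillingMonomial μ T S')

instance (μ : YoungDiagram) {n : ℕ} (T P : YDCells μ ≃ Fin n) :
    Decidable (IsSnaking μ T P) := by
  unfold IsSnaking; infer_instance

/-- A finite set of cells whose total height above the column tops is that of `μ`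
contains `μ`. -/
theorem YoungDiagram.cells_subset_of_sum_eq (μ : YoungDiagram) (F : Finset (ℕ × ℕ))
    (h : ∑ c ∈ F, ((c.1 : ℤ) - μ.colLen c.2) = ∑ c ∈ μ.cells, ((c.1 : ℤ) - μ.colLen c.2)) :
    μ.cells ⊆ F := by
  have hdiff := Finset.sum_sdiff_sub_sum_sdiff (s₁ := F) (s₂ := μ.cells)
    (f := fun c : ℕ × ℕ => (c.1 : ℤ) - μ.colLen c.2)
  have hF : 0 ≤ ∑ c ∈ F \ μ.cells, ((c.1 : ℤ) - μ.colLen c.2) := by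
    refine Finset.sum_nonneg fun c hc => ?_
    have hnot : ¬ c.1 < μ.colLen c.2 := fun hlt =>
      (Finset.mem_sdiff.1 hc).2 (YoungDiagram.mem_iff_lt_colLen.2 hlt)
    omega
  rw [← Finset.sdiff_eq_empty_iff_subset]
  by_contra hne
  have hμ : ∑ c ∈ μ.cells \ F, ((c.1 : ℤ) - μ.colLen c.2) < 0 := by
    refine Finset.sum_neg (fun c hc => ?_) (Finset.nonempty_iff_ne_empty.2 hne)
    have hlt : c.1 < μ.colLen c.2 :=
      YoungDiagram.mem_iff_lt_colLen.1 (Finset.mem_sdiff.1 hc).1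
    omega
  linarith

section Snaking

variable {μ : YoungDiagram} {n : ℕ} {T P : YDCells μ ≃ Fin n}

theorem mem_rowGroup {w : Equiv.Perm (Fin n)} :
    w ∈ rowGroup μ T ↔ ∀ v, (T.symm (w v) : ℕ × ℕ).1 = (T.symm v : ℕ × ℕ).1 := by
  simp [rowGroup]

theorem mem_colGroup {w : Equiv.Perm (Fin n)} :
    w ∈ colGroup μ T ↔ ∀ v, (T.symm (w v) : ℕ × ℕ).2 = (T.symm v : ℕ × ℕ).2 := by
  simp [colGroup]

theorem inv_mem_rowGroup {w : Equiv.Perm (Fin n)} (hw : w ∈ rowGroup μ T) :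
    w⁻¹ ∈ rowGroup μ T := by
  rw [mem_rowGroup] at hw ⊢
  intro v
  simpa using (hw (w⁻¹ v)).symm

theorem inv_mem_colGroup {w : Equiv.Perm (Fin n)} (hw : w ∈ colGroup μ T) :
    w⁻¹ ∈ colGroup μ T := by
  rw [mem_colGroup] at hw ⊢
  intro v
  simpa using (hw (w⁻¹ v)).symm

theorem symm_ext {v v' : Fin n} (h1 : (T.symm v : ℕ × ℕ).1 = (T.symm v' : ℕ × ℕ).1)
    (h2 : (T.symm v : ℕ × ℕ).2 = (T.symm v' : ℕ × ℕ).2) : v = v' :=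
  T.symm.injective (Subtype.ext (Prod.ext h1 h2))

theorem rename_fillingMonomial (w : Equiv.Perm (Fin n)) (S' : YDCells μ → ℕ) :
    rename (⇑w) (fillingMonomial μ T S') = fillingMonomial μ (T.trans w) S' := by
  simp [fillingMonomial]

/-- The row of a value in the filling `τσT` only depends on `τ`. -/
theorem row_trans_mul {τ σ : Equiv.Perm (Fin n)} (hσ : σ ∈ rowGroup μ T) (v : Fin n) :
    ((T.trans (τ * σ)).symm v : ℕ × ℕ).1 = (T.symm (τ⁻¹ v) : ℕ × ℕ).1 :=
  mem_rowGroup.1 (inv_mem_rowGroup hσ) (τ⁻¹ v)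

theorem isSnaking_trans_mul {τ σ : Equiv.Perm (Fin n)} (hτ : τ ∈ colGroup μ T)
    (hσ : σ ∈ rowGroup μ T) : IsSnaking μ T (T.trans (τ * σ)) := by
  intro v v' hne hcol hrow
  rw [row_trans_mul hσ, row_trans_mul hσ] at hrow
  have hτ' := mem_colGroup.1 (inv_mem_colGroup hτ)
  exact hne (τ⁻¹.injective (symm_ext hrow (by rw [hτ', hτ', hcol])))

theorem trans_mul_injective {τ σ τ' σ' : Equiv.Perm (Fin n)} (hτ : τ ∈ colGroup μ T)
    (hσ : σ ∈ rowGroup μ T) (hτ' : τ' ∈ colGroup μ T) (hσ' : σ' ∈ rowGroup μ T)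
    (h : T.trans (τ * σ) = T.trans (τ' * σ')) : τ = τ' ∧ σ = σ' := by
  have hτeq : τ = τ' := by
    refine inv_injective (Equiv.ext fun v => symm_ext (T := T) ?_ ?_)
    · rw [← row_trans_mul hσ, h, row_trans_mul hσ']
    · rw [mem_colGroup.1 (inv_mem_colGroup hτ), mem_colGroup.1 (inv_mem_colGroup hτ')]
  subst hτeq
  refine ⟨rfl, Equiv.ext fun v => τ.injective ?_⟩
  simpa using DFunLike.congr_fun h (T.symm v)

/-- Sending a value to its row in a snaking and its column in `T` lands in the diagram. -/
theorem IsSnaking.row_col_mem (hP : IsSnaking μ T P) (v : Fin n) :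
    ((P.symm v : ℕ × ℕ).1, (T.symm v : ℕ × ℕ).2) ∈ μ.cells := by
  set f : Fin n → ℕ × ℕ := fun v => ((P.symm v : ℕ × ℕ).1, (T.symm v : ℕ × ℕ).2)
  have hinj : Function.Injective f := by
    intro v v' h
    by_contra hne
    exact hP v v' hne (Prod.ext_iff.1 h).2 (Prod.ext_iff.1 h).1
  have hrow : ∑ v, ((P.symm v : ℕ × ℕ).1 : ℤ) = ∑ c ∈ μ.cells, (c.1 : ℤ) := by
    rw [← Finset.sum_coe_sort μ.cells]
    exact Equiv.sum_comp P.symm fun c : YDCells μ => (((c : ℕ × ℕ).1 : ℕ) : ℤ)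
  have hcol : ∑ v, (μ.colLen (T.symm v : ℕ × ℕ).2 : ℤ) =
      ∑ c ∈ μ.cells, (μ.colLen c.2 : ℤ) := by
    rw [← Finset.sum_coe_sort μ.cells]
    exact Equiv.sum_comp T.symm fun c : YDCells μ => ((μ.colLen (c : ℕ × ℕ).2 : ℕ) : ℤ)
  have hsub : μ.cells ⊆ Finset.univ.image f := by
    apply μ.cells_subset_of_sum_eq
    rw [Finset.sum_image fun a _ b _ h => hinj h, Finset.sum_sub_distrib,
      Finset.sum_sub_distrib, ← hrow, ← hcol]
  have hcard : (Finset.univ.image f).card = μ.cells.card := by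
    rw [Finset.card_image_of_injective _ hinj, Finset.card_univ, ← Fintype.card_congr T,
      Fintype.card_coe]
  have hmem := Finset.mem_image_of_mem f (Finset.mem_univ v)
  rwa [← Finset.eq_of_subset_of_card_le hsub hcard.le] at hmem

theorem IsSnaking.exists_eq_trans_mul (hP : IsSnaking μ T P) :
    ∃ τ ∈ colGroup μ T, ∃ σ ∈ rowGroup μ T, T.trans (τ * σ) = P := by
  let g : Fin n → Fin n := fun v =>
    T ⟨((P.symm v : ℕ × ℕ).1, (T.symm v : ℕ × ℕ).2), hP.row_col_mem v⟩
  have hg : Function.Injective g := by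
    intro v v' h
    have h' := congrArg Subtype.val (T.injective h)
    by_contra hne
    exact hP v v' hne (Prod.ext_iff.1 h').2 (Prod.ext_iff.1 h').1
  let ρ : Equiv.Perm (Fin n) := Equiv.ofBijective g (Finite.injective_iff_bijective.1 hg)
  have hρ : ∀ v, (T.symm (ρ v) : ℕ × ℕ) = ((P.symm v : ℕ × ℕ).1, (T.symm v : ℕ × ℕ).2) := by
    intro v
    change ((T.symm (T _) : YDCells μ) : ℕ × ℕ) = _
    rw [T.symm_apply_apply]
  refine ⟨ρ⁻¹, inv_mem_colGroup (mem_colGroup.2 fun v => by rw [hρ]),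
    ρ * (T.symm.trans P), mem_rowGroup.2 fun v => ?_, ?_⟩
  · rw [Equiv.Perm.mul_apply, hρ]
    simp
  · ext c
    simp

theorem sign_eq_neg_one_pow_snakeInv (hT : IsStandardFilling μ T) {τ σ : Equiv.Perm (Fin n)}
    (hτ : τ ∈ colGroup μ T) (hσ : σ ∈ rowGroup μ T) :
    ((Equiv.Perm.sign τ : ℤ) : ℚ) = (-1) ^ snakeInv μ T (T.trans (τ * σ)) := by
  have hρ := mem_colGroup.1 (inv_mem_colGroup hτ)
  let col : Fin n → ℕ := fun v => (T.symm v : ℕ × ℕ).2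
  let f : Fin n → Fin n → ℚ := fun i j =>
    if col i < col j ∨ col i = col j ∧ i < j then 1
    else if col j < col i ∨ col j = col i ∧ j < i then -1 else 0
  have hanti : ∀ i j, f i j = -f j i := by
    intro i j
    simp only [f]
    split_ifs <;> first | omega | simp
  have hrow : ∀ i j, col i = col j → ((T.symm i : ℕ × ℕ).1 < (T.symm j : ℕ × ℕ).1 ↔ i < j) := by
    intro i j hij
    constructor
    · intro h
      simpa using hT.2 (T.symm i) (T.symm j) hij h
    · intro h
      by_contra hle
      rcases (not_lt.1 hle).lt_or_eq with hlt | heq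
      · have := hT.2 (T.symm j) (T.symm i) hij.symm hlt
        simp only [Equiv.apply_symm_apply] at this
        exact lt_asymm h this
      · exact h.ne (symm_ext heq.symm hij)
  have key := Equiv.Perm.prod_Ioi_comp_eq_sign_mul_prod τ⁻¹ hanti
  have hne : ∏ i, ∏ j ∈ Finset.Ioi i, f i j ≠ 0 := by
    refine Finset.prod_ne_zero_iff.2 fun i _ => Finset.prod_ne_zero_iff.2 fun j hj => ?_
    have hij : i < j := Finset.mem_Ioi.1 hj
    simp only [f]
    split_ifs <;> first | omega | simp
  have hterm : ∀ i j, i < j → f (τ⁻¹ i) (τ⁻¹ j) =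
      (if col i = col j ∧ i < j ∧ (T.symm (τ⁻¹ j) : ℕ × ℕ).1 < (T.symm (τ⁻¹ i) : ℕ × ℕ).1
        then -1 else 1) * f i j := by
    intro i j hij
    have hi : col (τ⁻¹ i) = col i := hρ i
    have hj : col (τ⁻¹ j) = col j := hρ j
    have hne : τ⁻¹ i ≠ τ⁻¹ j := τ⁻¹.injective.ne hij.ne
    by_cases hc : col i = col j
    · simp only [hrow (τ⁻¹ j) (τ⁻¹ i) (by rw [hi, hj, hc])]
      simp only [f, hi, hj]
      rcases lt_or_gt_of_ne hne with h | h <;>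
        simp only [hc, hij, h, h.not_gt, lt_irrefl, true_and, false_or, if_true, if_false,
          mul_one]
    · simp only [f, hi, hj]
      simp [hc, Ne.symm hc]
  have hprod : ∏ i, ∏ j ∈ Finset.Ioi i, f (τ⁻¹ i) (τ⁻¹ j) =
      (-1) ^ snakeInv μ T (T.trans (τ * σ)) * ∏ i, ∏ j ∈ Finset.Ioi i, f i j := by
    rw [Finset.prod_congr rfl fun i _ => Finset.prod_congr rfl fun j hj =>
      hterm i j (Finset.mem_Ioi.1 hj)]
    simp_rw [Finset.prod_mul_distrib]
    congr 1
    rw [snakeInv, ← Finset.prod_const, Finset.prod_filter, Fintype.prod_prod_type]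
    refine Finset.prod_congr rfl fun i _ => ?_
    simp_rw [row_trans_mul hσ]
    refine Finset.prod_subset (Finset.subset_univ _) fun j _ hj => ?_
    rw [if_neg]
    exact fun h => hj (Finset.mem_Ioi.2 h.2.1)
  rw [hprod, Equiv.Perm.sign_inv] at key
  exact (mul_right_cancel₀ hne key).symm

end Snaking

theorem statement17 (n : ℕ) (μ : YoungDiagram) (hcard : μ.cells.card = n)
    (T : YDCells μ ≃ Fin n) (hT : IsStandardFilling μ T) (S' : YDCells μ → ℕ) :
    epsilonApplied μ T S' =
      ∑ P ∈ Finset.univ.filter (fun P : YDCells μ ≃ Fin n => IsSnaking μ T P),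
        ((-1 : ℚ) ^ snakeInv μ T P) • fillingMonomial μ P S' := by
  simp_rw [epsilonApplied, rename_fillingMonomial]
  rw [← Finset.sum_product']
  refine Finset.sum_bij (fun p _ => T.trans (p.1 * p.2)) ?_ ?_ ?_ ?_
  · intro p hp
    rw [Finset.mem_product] at hp
    exact Finset.mem_filter.2 ⟨Finset.mem_univ _, isSnaking_trans_mul hp.1 hp.2⟩
  · intro p hp q hq h
    rw [Finset.mem_product] at hp hq
    obtain ⟨h1, h2⟩ := trans_mul_injective hp.1 hp.2 hq.1 hq.2 h
    exact Prod.ext h1 h2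
  · intro P hP
    obtain ⟨τ, hτ, σ, hσ, h⟩ := (Finset.mem_filter.1 hP).2.exists_eq_trans_mul
    exact ⟨(τ, σ), Finset.mem_product.2 ⟨hτ, hσ⟩, h⟩
  · intro p hp
    rw [Finset.mem_product] at hp
    rw [sign_eq_neg_one_pow_snakeInv hT hp.1 hp.2]
end
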